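/- arXiv:2504.13449 — 2 statements merged into one kernel-verified Lean document; each statement's English description precedes it below -/
import Mathlib

section
/- Lemma 3.6. Assume condition (V). Then for every r with 2≤r<∞, the quantities β_k := sup{ ‖u‖_r + ‖v‖_r : (u,v)∈Z_k, ‖(u,v)‖=1 } satisfy β_k → 0 as k→∞. -/
open Filter Topology

/-- A connected, locally finite weighted graph `G = (V, E)` with symmetric positive edge
weights `w` (vanishing off edges) and a vertex measure `mu` with positive lower bound
`mumin`. -/
structure WeightedGraph (V : Type*) where
  G : SimpleGraph V
  connected : G.Connected
  locallyFinite : ∀ x : V, (G.neighborSet x).Finite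
  w : V → V → ℝ
  w_symm : ∀ x y, w x y = w y x
  w_pos : ∀ x y, G.Adj x y → 0 < w x y
  w_eq_zero : ∀ x y, ¬ G.Adj x y → w x y = 0
  mu : V → ℝ
  mumin : ℝ
  mumin_pos : 0 < mumin
  mu_ge : ∀ x, mumin ≤ mu x

namespace WeightedGraph

variable {V : Type*} (S : WeightedGraph V)

/-- `∫_V φ dμ = Σ_{x ∈ V} φ(x) μ(x)`. -/
noncomputable def integral (φ : V → ℝ) : ℝ := ∑' x, φ x * S.mu x

/-- The graph Laplacian `Δu(x) = (1/μ(x)) Σ_{y ∼ x} w_{xy} (u(y) - u(x))`. -/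
noncomputable def lap (u : V → ℝ) (x : V) : ℝ :=
  (1 / S.mu x) * ∑' y, S.w x y * (u y - u x)

/-- `|∇u|²(x) = (1/(2μ(x))) Σ_{y ∼ x} w_{xy} (u(y) - u(x))²`. -/
noncomputable def gradSq (u : V → ℝ) (x : V) : ℝ :=
  (1 / (2 * S.mu x)) * ∑' y, S.w x y * (u y - u x) ^ 2

/-- `∇u·∇v(x) = (1/(2μ(x))) Σ_{y ∼ x} w_{xy} (u(y) - u(x))(v(y) - v(x))`. -/
noncomputable def gradDot (u v : V → ℝ) (x : V) : ℝ :=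
  (1 / (2 * S.mu x)) * ∑' y, S.w x y * (u y - u x) * (v y - v x)

/-- The `L^r` norm `‖u‖_r = (∫_V |u|^r dμ)^{1/r}` for `1 ≤ r < ∞`. -/
noncomputable def normLr (r : ℝ) (u : V → ℝ) : ℝ :=
  (S.integral fun x => |u x| ^ r) ^ (1 / r)

/-- The density `|Δu|² + a |∇u|² + V(x) u²` defining the norm of the space `E_i`. -/
noncomputable def energyDensity (a : ℝ) (Vp : V → ℝ) (u : V → ℝ) (x : V) : ℝ :=
  (S.lap u x) ^ 2 + a * S.gradSq u x + Vp x * (u x) ^ 2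

/-- Membership in the working space `E_i` (finiteness of the `E_i`-norm). -/
def memE (a : ℝ) (Vp : V → ℝ) (u : V → ℝ) : Prop :=
  Summable fun x => S.energyDensity a Vp u x * S.mu x

/-- The norm `‖u‖_{E_i} = (∫_V (|Δu|² + a_i |∇u|² + V_i(x)u²) dμ)^{1/2}`. -/
noncomputable def normE (a : ℝ) (Vp : V → ℝ) (u : V → ℝ) : ℝ :=
  Real.sqrt (S.integral (S.energyDensity a Vp u))

/-- The inner product `(u,v)_{E_i} = ∫_V (Δu Δv + a_i ∇u·∇v + V_i(x) u v) dμ`. -/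
noncomputable def innerE (a : ℝ) (Vp : V → ℝ) (u v : V → ℝ) : ℝ :=
  S.integral fun x => S.lap u x * S.lap v x + a * S.gradDot u v x + Vp x * u x * v x

/-- The energy functional `Φ` of the biharmonic–Kirchhoff system. -/
noncomputable def Phi (a₁ a₂ b₁ b₂ : ℝ) (V₁ V₂ : V → ℝ) (F : V → ℝ → ℝ → ℝ)
    (u v : V → ℝ) : ℝ :=
  (1/2) * S.integral (S.energyDensity a₁ V₁ u) + (1/2) * S.integral (S.energyDensity a₂ V₂ v)
    + (b₁/4) * (S.integral (S.gradSq u)) ^ 2 + (b₂/4) * (S.integral (S.gradSq v)) ^ 2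
    - S.integral fun x => F x (u x) (v x)

/-- The action `⟨Φ'(u,v), (φ₁,φ₂)⟩` of the derivative of `Φ`. -/
noncomputable def PhiDeriv (a₁ a₂ b₁ b₂ : ℝ) (V₁ V₂ : V → ℝ) (Fs Ft : V → ℝ → ℝ → ℝ)
    (u v φ₁ φ₂ : V → ℝ) : ℝ :=
  S.innerE a₁ V₁ u φ₁ + S.innerE a₂ V₂ v φ₂
    + b₁ * S.integral (S.gradSq u) * S.integral (S.gradDot u φ₁)
    + b₂ * S.integral (S.gradSq v) * S.integral (S.gradDot v φ₂)
    - S.integral (fun x => Fs x (u x) (v x) * φ₁ x)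
    - S.integral (fun x => Ft x (u x) (v x) * φ₂ x)

/-- `(u,v)` solves the biharmonic–Kirchhoff system (pointwise on `V`). -/
def IsSolution (a₁ a₂ b₁ b₂ : ℝ) (V₁ V₂ : V → ℝ) (Fs Ft : V → ℝ → ℝ → ℝ)
    (u v : V → ℝ) : Prop :=
  (∀ x, S.lap (S.lap u) x - (a₁ + b₁ * S.integral (S.gradSq u)) * S.lap u x + V₁ x * u x
      = Fs x (u x) (v x)) ∧
  (∀ x, S.lap (S.lap v) x - (a₂ + b₂ * S.integral (S.gradSq v)) * S.lap v x + V₂ x * v x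
      = Ft x (u x) (v x))

/-- Condition (V): `θᵢ = inf_V Vᵢ > 0` and `Vᵢ(x) → +∞` as `d(x,x₀) → ∞`. -/
def CondV (V₁ V₂ : V → ℝ) (θ₁ θ₂ : ℝ) : Prop :=
  IsGLB (Set.range V₁) θ₁ ∧ IsGLB (Set.range V₂) θ₂ ∧ 0 < θ₁ ∧ 0 < θ₂ ∧
    ∃ x₀ : V, ∀ M : ℝ, ∃ N : ℕ, ∀ x : V, N ≤ S.G.dist x₀ x → M ≤ V₁ x ∧ M ≤ V₂ x

/-- Condition (F₀). -/
def CondF0 (F : V → ℝ → ℝ → ℝ) : Prop :=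
  (∀ x, F x 0 0 = 0) ∧ ∀ x, ContDiff ℝ 1 (fun p : ℝ × ℝ => F x p.1 p.2)

/-- `Fs` and `Ft` are the partial derivatives of `F` in its last two arguments. -/
def IsPartialDerivs (F Fs Ft : V → ℝ → ℝ → ℝ) : Prop :=
  ∀ x s t, HasDerivAt (fun s' => F x s' t) (Fs x s t) s ∧
           HasDerivAt (fun t' => F x s t') (Ft x s t) t

/-- Condition (F₁). -/
def CondF1 (F Fs Ft : V → ℝ → ℝ → ℝ) (a : ℝ → ℝ) (b : V → ℝ) : Prop :=
  ContinuousOn a (Set.Ici 0) ∧ (∀ r : ℝ, 0 ≤ r → 0 ≤ a r) ∧ (∀ x, 0 < b x) ∧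
    Summable (fun x => b x * S.mu x) ∧
    ∀ x s t, |Fs x s t| ≤ a (Real.sqrt (s ^ 2 + t ^ 2)) * b x ∧
             |Ft x s t| ≤ a (Real.sqrt (s ^ 2 + t ^ 2)) * b x ∧
             |F x s t| ≤ a (Real.sqrt (s ^ 2 + t ^ 2)) * b x

/-- Condition (C₁): `lim_{r → 0⁺} a(r)/r² = h < ∞`. -/
def CondC1 (a : ℝ → ℝ) : Prop :=
  ∃ h : ℝ, Tendsto (fun r => a r / r ^ 2) (nhdsWithin 0 (Set.Ioi 0)) (nhds h)

/-- `γ_{∞,i} = (μ_min · inf_V V_i)^{-1/2}`. -/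
noncomputable def gammaInf (θ : ℝ) : ℝ := 1 / Real.sqrt (S.mumin * θ)

/-- Condition (C₂). -/
def CondC2 (a : ℝ → ℝ) (b : V → ℝ) (θ₁ θ₂ : ℝ) : Prop :=
  ∃ ρ : ℝ, 0 < ρ ∧
    0 < ρ ^ 2 / 4 - sSup (a '' Set.Icc 0 ((S.gammaInf θ₁ + S.gammaInf θ₂) * ρ)) * S.integral b

/-- Condition (F₂): `F(x,s,t)/|(s,t)|⁴ → +∞` as `|(s,t)| → ∞`, uniformly in `x`. -/
def CondF2 (F : V → ℝ → ℝ → ℝ) : Prop :=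
  ∀ M : ℝ, ∃ R : ℝ, ∀ x s t, R ≤ Real.sqrt (s ^ 2 + t ^ 2) → M * (s ^ 2 + t ^ 2) ^ 2 ≤ F x s t

/-- Condition (F₂)': `F(x,s,t)/|(s,t)|² → +∞` as `|(s,t)| → ∞`, uniformly in `x`. -/
def CondF2' (F : V → ℝ → ℝ → ℝ) : Prop :=
  ∀ M : ℝ, ∃ R : ℝ, ∀ x s t, R ≤ Real.sqrt (s ^ 2 + t ^ 2) → M * (s ^ 2 + t ^ 2) ≤ F x s t

/-- Condition (F₃): `F ≥ 0` outside the ball of radius `r₀`. -/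
def CondF3 (F : V → ℝ → ℝ → ℝ) (r₀ : ℝ) : Prop :=
  ∀ x s t, r₀ ≤ Real.sqrt (s ^ 2 + t ^ 2) → 0 ≤ F x s t

/-- `𝓕(x,s,t) = λ (s F_s + t F_t) - F` (with `λ = 1/4` resp. `1/2`). -/
noncomputable def curlyF (lam : ℝ) (F Fs Ft : V → ℝ → ℝ → ℝ) (x : V) (s t : ℝ) : ℝ :=
  lam * (s * Fs x s t + t * Ft x s t) - F x s t

/-- Condition (F₄) (with `λ = 1/4`); `k` is a real exponent and `^` is `Real.rpow`. -/
def CondF4 (F Fs Ft : V → ℝ → ℝ → ℝ) (r₀ : ℝ) : Prop :=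
  (∀ (x : V) (s t : ℝ), 0 ≤ curlyF (1/4) F Fs Ft x s t) ∧
  ∃ c : ℝ, 0 < c ∧ ∃ k : ℝ, 1 < k ∧ ∀ (x : V) (s t : ℝ), r₀ ≤ Real.sqrt (s ^ 2 + t ^ 2) →
    |F x s t| ^ k ≤ c * (s ^ 2 + t ^ 2) ^ k * curlyF (1/4) F Fs Ft x s t

/-- Condition (F₄)' (with `λ = 1/2`). -/
def CondF4' (F Fs Ft : V → ℝ → ℝ → ℝ) (r₀ : ℝ) : Prop :=
  (∀ (x : V) (s t : ℝ), 0 ≤ curlyF (1/2) F Fs Ft x s t) ∧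
  ∃ c : ℝ, 0 < c ∧ ∃ k : ℝ, 1 < k ∧ ∀ (x : V) (s t : ℝ), r₀ ≤ Real.sqrt (s ^ 2 + t ^ 2) →
    |F x s t| ^ k ≤ c * (s ^ 2 + t ^ 2) ^ k * curlyF (1/2) F Fs Ft x s t

/-- `γ_{2,i} = (inf_V V_i)^{-1/2}`. -/
noncomputable def gamma2 (θ : ℝ) : ℝ := 1 / Real.sqrt θ

/-- Condition (F₅) (`lb = 4`), resp. (F₅)' (`lb = 2`): there are `μ̄ > lb` and an admissible
`σ` with `μ̄ F ≤ s F_s + t F_t + σ (s² + t²)`. -/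
def CondF5 (lb : ℝ) (F Fs Ft : V → ℝ → ℝ → ℝ) (θ₁ θ₂ : ℝ) : Prop :=
  ∃ μb : ℝ, lb < μb ∧ ∃ σ : ℝ, 0 < σ ∧
    σ < (μb - 2) / (2 * max (gamma2 θ₁ ^ 2) (gamma2 θ₂ ^ 2)) ∧
    ∀ (x : V) (s t : ℝ), μb * F x s t ≤ s * Fs x s t + t * Ft x s t + σ * (s ^ 2 + t ^ 2)

/-- Condition (F₆): `F` is even in `(s,t)`. -/
def CondF6 (F : V → ℝ → ℝ → ℝ) : Prop :=
  ∀ (x : V) (s t : ℝ), F x (-s) (-t) = F x s t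

/-- A Cerami sequence for `Φ`: `Φ(uₙ,vₙ)` is bounded and
`(1 + ‖(uₙ,vₙ)‖)‖Φ'(uₙ,vₙ)‖_{E*} → 0`. -/
def CeramiSeq (a₁ a₂ b₁ b₂ : ℝ) (V₁ V₂ : V → ℝ) (F Fs Ft : V → ℝ → ℝ → ℝ)
    (u v : ℕ → V → ℝ) : Prop :=
  (∀ n, S.memE a₁ V₁ (u n) ∧ S.memE a₂ V₂ (v n)) ∧
  (∃ C : ℝ, ∀ n, |S.Phi a₁ a₂ b₁ b₂ V₁ V₂ F (u n) (v n)| ≤ C) ∧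
  ∃ ε : ℕ → ℝ, Tendsto ε atTop (nhds 0) ∧
    ∀ (n : ℕ) (φ₁ φ₂ : V → ℝ), S.memE a₁ V₁ φ₁ → S.memE a₂ V₂ φ₂ →
      S.normE a₁ V₁ φ₁ + S.normE a₂ V₂ φ₂ ≤ 1 →
      (1 + (S.normE a₁ V₁ (u n) + S.normE a₂ V₂ (v n))) *
        |S.PhiDeriv a₁ a₂ b₁ b₂ V₁ V₂ Fs Ft (u n) (v n) φ₁ φ₂| ≤ ε n

end WeightedGraph

open WeightedGraph

namespace WeightedGraph

variable {V : Type*} (S : WeightedGraph V)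

lemma mu_pos (x : V) : 0 < S.mu x := S.mumin_pos.trans_le (S.mu_ge x)

lemma w_nonneg (x y : V) : 0 ≤ S.w x y := by
  by_cases h : S.G.Adj x y
  · exact (S.w_pos x y h).le
  · exact (S.w_eq_zero x y h).ge

lemma tsum_w_mul (x : V) (g : V → ℝ) :
    ∑' y, S.w x y * g y = ∑ y ∈ (S.locallyFinite x).toFinset, S.w x y * g y := by
  refine tsum_eq_sum fun y hy => ?_
  have : ¬ S.G.Adj x y := by simpa using hy
  rw [S.w_eq_zero x y this, zero_mul]

lemma finite_setOf_walk_length_eq (n : ℕ) (x : V) :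
    {y | ∃ p : S.G.Walk x y, p.length = n}.Finite := by
  induction n generalizing x with
  | zero =>
    refine (Set.finite_singleton x).subset ?_
    rintro y ⟨p, hp⟩
    exact (SimpleGraph.Walk.eq_of_length_eq_zero hp).symm
  | succ n ih =>
    refine ((S.locallyFinite x).biUnion fun z _ => ih z).subset ?_
    rintro y ⟨p, hp⟩
    cases p with
    | nil => simp at hp
    | cons h q =>
      simp only [SimpleGraph.Walk.length_cons, Nat.add_right_cancel_iff] at hp
      exact Set.mem_biUnion (x := _) h ⟨q, hp⟩

lemma finite_setOf_dist_lt (x : V) (N : ℕ) : {y | S.G.dist x y < N}.Finite := by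
  refine ((Set.finite_Iio N).biUnion fun n _ => S.finite_setOf_walk_length_eq n x).subset ?_
  intro y hy
  obtain ⟨p, hp⟩ := (S.connected x y).exists_walk_length_eq_dist
  exact Set.mem_biUnion (x := S.G.dist x y) hy ⟨p, hp⟩

/-- The density of the inner product `(u, v)_E`. -/
noncomputable def innerDensity (a : ℝ) (Vp u v : V → ℝ) (x : V) : ℝ :=
  S.lap u x * S.lap v x + a * S.gradDot u v x + Vp x * u x * v x

lemma innerDensity_self (a : ℝ) (Vp u : V → ℝ) (x : V) :
    S.innerDensity a Vp u u x = S.energyDensity a Vp u x := by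
  simp only [innerDensity, energyDensity, gradDot, gradSq, mul_assoc, ← pow_two]

lemma gradSq_nonneg (u : V → ℝ) (x : V) : 0 ≤ S.gradSq u x :=
  mul_nonneg (by have := S.mu_pos x; positivity)
    (tsum_nonneg fun y => mul_nonneg (S.w_nonneg x y) (sq_nonneg _))

lemma mul_sq_le_energyDensity {a : ℝ} (ha : 0 ≤ a) (Vp u : V → ℝ) (x : V) :
    Vp x * u x ^ 2 ≤ S.energyDensity a Vp u x := by
  have h1 := mul_nonneg ha (S.gradSq_nonneg u x)
  have h2 := sq_nonneg (S.lap u x)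
  unfold energyDensity
  linarith

lemma energyDensity_mul_mu_nonneg {a : ℝ} (ha : 0 ≤ a) {Vp : V → ℝ} (hVp : ∀ x, 0 ≤ Vp x)
    (u : V → ℝ) (x : V) : 0 ≤ S.energyDensity a Vp u x * S.mu x :=
  mul_nonneg ((mul_nonneg (hVp x) (sq_nonneg _)).trans (S.mul_sq_le_energyDensity ha Vp u x))
    (S.mu_pos x).le

lemma abs_mul_le_add {t : ℝ} (ht : 0 < t) (p q : ℝ) :
    |p * q| ≤ t * p ^ 2 + t⁻¹ * q ^ 2 := by
  have h : t * p ^ 2 + t⁻¹ * q ^ 2 - 2 * (|p| * |q|) = t * (|p| - t⁻¹ * |q|) ^ 2 := by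
    rw [← sq_abs p, ← sq_abs q]
    field_simp
    ring
  have h2 : 0 ≤ t * (|p| - t⁻¹ * |q|) ^ 2 := by positivity
  rw [abs_mul]
  have : 0 ≤ |p| * |q| := by positivity
  linarith

lemma abs_gradDot_le {t : ℝ} (ht : 0 < t) (u v : V → ℝ) (x : V) :
    |S.gradDot u v x| ≤ t * S.gradSq u x + t⁻¹ * S.gradSq v x := by
  have hm := S.mu_pos x
  have hc : 0 ≤ 1 / (2 * S.mu x) := by positivity
  simp only [gradDot, gradSq, mul_assoc]
  rw [S.tsum_w_mul, S.tsum_w_mul, S.tsum_w_mul, abs_mul, abs_of_nonneg hc,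
    show ∀ A B C : ℝ, t * (A * B) + t⁻¹ * (A * C) = A * (t * B + t⁻¹ * C) by intros; ring,
    Finset.mul_sum, Finset.mul_sum, ← Finset.sum_add_distrib]
  refine mul_le_mul_of_nonneg_left ((Finset.abs_sum_le_sum_abs _ _).trans
    (Finset.sum_le_sum fun y _ => ?_)) hc
  rw [abs_mul, abs_of_nonneg (S.w_nonneg x y)]
  calc _ ≤ S.w x y * (t * (u y - u x) ^ 2 + t⁻¹ * (v y - v x) ^ 2) :=
        mul_le_mul_of_nonneg_left (abs_mul_le_add ht _ _) (S.w_nonneg x y)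
    _ = _ := by ring

lemma abs_innerDensity_mul_mu_le {a : ℝ} (ha : 0 ≤ a) {Vp : V → ℝ} (hVp : ∀ x, 0 ≤ Vp x)
    {t : ℝ} (ht : 0 < t) (u v : V → ℝ) (x : V) :
    |S.innerDensity a Vp u v x * S.mu x| ≤
      t * (S.energyDensity a Vp u x * S.mu x) + t⁻¹ * (S.energyDensity a Vp v x * S.mu x) := by
  rw [abs_mul, abs_of_pos (S.mu_pos x), ← mul_assoc, ← mul_assoc, ← add_mul]
  refine mul_le_mul_of_nonneg_right ?_ (S.mu_pos x).le
  have h1 := abs_mul_le_add ht (S.lap u x) (S.lap v x)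
  have h2 := mul_le_mul_of_nonneg_left (S.abs_gradDot_le ht u v x) ha
  have h3 := mul_le_mul_of_nonneg_left (abs_mul_le_add ht (u x) (v x)) (hVp x)
  rw [← abs_of_nonneg ha, ← abs_mul, abs_of_nonneg ha] at h2
  rw [← abs_of_nonneg (hVp x), ← abs_mul, abs_of_nonneg (hVp x), ← mul_assoc] at h3
  refine (abs_add_three _ _ _).trans ((add_le_add_three h1 h2 h3).trans_eq ?_)
  unfold energyDensity
  ring

lemma summable_innerDensity {a : ℝ} (ha : 0 ≤ a) {Vp : V → ℝ} (hVp : ∀ x, 0 ≤ Vp x)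
    {u v : V → ℝ} (hu : S.memE a Vp u) (hv : S.memE a Vp v) :
    Summable fun x => S.innerDensity a Vp u v x * S.mu x :=
  .of_norm_bounded (g := fun x => 1 * (S.energyDensity a Vp u x * S.mu x) +
      1⁻¹ * (S.energyDensity a Vp v x * S.mu x)) ((Summable.mul_left 1 hu).add (Summable.mul_left 1⁻¹ hv))
    fun x => S.abs_innerDensity_mul_mu_le ha hVp one_pos u v x

lemma tendsto_innerDensity {ι : Type*} {l : Filter ι} {u : ι → V → ℝ} {f : V → ℝ}
    (hu : Tendsto u l (𝓝 f)) {v : ι → V → ℝ} {g : V → ℝ} (hv : Tendsto v l (𝓝 g))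
    (a : ℝ) (Vp : V → ℝ) (x : V) :
    Tendsto (fun i => S.innerDensity a Vp (u i) (v i) x * S.mu x) l
      (𝓝 (S.innerDensity a Vp f g x * S.mu x)) := by
  rw [tendsto_pi_nhds] at hu hv
  have hlap {u : ι → V → ℝ} {f : V → ℝ} (hu : ∀ y, Tendsto (fun i => u i y) l (𝓝 (f y))) :
      Tendsto (fun i => S.lap (u i) x) l (𝓝 (S.lap f x)) := by
    simp only [lap, S.tsum_w_mul]
    exact (tendsto_finsetSum _ fun y _ => ((hu y).sub (hu x)).const_mul _).const_mul _
  have hgrad : Tendsto (fun i => S.gradDot (u i) (v i) x) l (𝓝 (S.gradDot f g x)) := by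
    simp only [gradDot, mul_assoc, S.tsum_w_mul]
    exact (tendsto_finsetSum _ fun y _ =>
      (((hu y).sub (hu x)).mul ((hv y).sub (hv x))).const_mul _).const_mul _
  exact ((((hlap hu).mul (hlap hv)).add (hgrad.const_mul a)).add
    (((hu x).const_mul (Vp x)).mul (hv x))).mul_const (S.mu x)

lemma abs_sum_innerDensity_le_of_innerE_eq_zero {a : ℝ} (ha : 0 ≤ a) {Vp : V → ℝ}
    (hVp : ∀ x, 0 ≤ Vp x) {u v : V → ℝ} (hu : S.memE a Vp u) (hv : S.memE a Vp v)
    (hu1 : S.integral (S.energyDensity a Vp u) ≤ 1) (h0 : S.innerE a Vp u v = 0)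
    {t : ℝ} (ht : 0 < t) (F : Finset V) :
    |∑ x ∈ F, S.innerDensity a Vp u v x * S.mu x| ≤
      t + t⁻¹ * (S.integral (S.energyDensity a Vp v) -
        ∑ x ∈ F, S.energyDensity a Vp v x * S.mu x) := by
  have hs := S.summable_innerDensity ha hVp hu hv
  have h1 := hs.sum_add_tsum_subtype_compl F
  have h2 := Summable.sum_add_tsum_subtype_compl hu F
  have h3 := Summable.sum_add_tsum_subtype_compl hv F
  have h0' : ∑' x, S.innerDensity a Vp u v x * S.mu x = 0 := h0
  have hu' : ∑' x, S.energyDensity a Vp u x * S.mu x ≤ 1 := hu1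
  have hpos : 0 ≤ ∑ x ∈ F, S.energyDensity a Vp u x * S.mu x :=
    Finset.sum_nonneg fun x _ => S.energyDensity_mul_mu_nonneg ha hVp u x
  have hsu := (Summable.subtype hu {x | x ∉ F}).mul_left t
  have hsv := (Summable.subtype hv {x | x ∉ F}).mul_left t⁻¹
  have key := tsum_of_norm_bounded
    (f := fun x : {x | x ∉ F} => S.innerDensity a Vp u v x * S.mu x) (hsu.add hsv).hasSum
    (fun x => S.abs_innerDensity_mul_mu_le ha hVp ht u v x)
  rw [hsu.tsum_add hsv, tsum_mul_left, tsum_mul_left] at key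
  have e1 : ∑ x ∈ F, S.innerDensity a Vp u v x * S.mu x =
      -∑' x : {x | x ∉ F}, S.innerDensity a Vp u v x * S.mu x := by
    rw [h0'] at h1
    exact eq_neg_of_add_eq_zero_left h1
  rw [e1, abs_neg]
  refine key.trans (add_le_add ?_ (mul_le_mul_of_nonneg_left ?_ (by positivity)))
  · refine mul_le_of_le_one_right ht.le ?_
    change ∑' x : {x // x ∉ F}, S.energyDensity a Vp u x * S.mu x ≤ 1
    linarith
  · exact (eq_sub_of_add_eq' h3).le

/-- Elements of the unit ball of `E` orthogonal to the first `k` elements of a total family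
tend to zero pointwise, uniformly, as `k → ∞`. -/
lemma eventually_sq_apply_le {a : ℝ} (ha : 0 ≤ a) {Vp : V → ℝ} {θ : ℝ} (hθ : 0 < θ)
    (hVp : ∀ x, θ ≤ Vp x) {e : ℕ → V → ℝ} (he : ∀ j, S.memE a Vp (e j))
    (htot : ∀ u : V → ℝ, S.memE a Vp u → (∀ j, S.innerE a Vp u (e j) = 0) → u = 0)
    (x : V) {δ : ℝ} (hδ : 0 < δ) :
    ∀ᶠ k : ℕ in atTop, ∀ u : V → ℝ, S.memE a Vp u → (∀ j < k, S.innerE a Vp u (e j) = 0) →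
      S.integral (S.energyDensity a Vp u) ≤ 1 → u x ^ 2 ≤ δ := by
  have hVp0 : ∀ x, 0 ≤ Vp x := fun x => hθ.le.trans (hVp x)
  have hmm := S.mumin_pos
  by_contra hcon
  have hex : ∀ n : ℕ, ∃ u : V → ℝ, S.memE a Vp u ∧ (∀ j < n, S.innerE a Vp u (e j) = 0) ∧
      S.integral (S.energyDensity a Vp u) ≤ 1 ∧ δ < u x ^ 2 := by
    intro n
    by_contra! hn
    refine hcon (eventually_atTop.2 ⟨n, fun k hk u hu ho h1 => ?_⟩)
    exact hn u hu (fun j hj => ho j (hj.trans_le hk)) h1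
  choose u hu ho h1 hx using hex
  have hsum : ∀ (n : ℕ) (F : Finset V),
      ∑ y ∈ F, S.energyDensity a Vp (u n) y * S.mu y ≤ 1 := fun n F =>
    (Summable.sum_le_tsum F (fun y _ => S.energyDensity_mul_mu_nonneg ha hVp0 _ y) (hu n)).trans
      (h1 n)
  have hbd : ∀ n y, |u n y| ≤ √(1 / (θ * S.mumin)) := by
    intro n y
    refine Real.abs_le_sqrt ((le_div_iff₀ (by positivity)).2 ?_)
    have h2 := hsum n {y}
    rw [Finset.sum_singleton] at h2
    calc u n y ^ 2 * (θ * S.mumin) = θ * u n y ^ 2 * S.mumin := by ring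
      _ ≤ Vp y * u n y ^ 2 * S.mu y :=
        mul_le_mul (mul_le_mul_of_nonneg_right (hVp y) (sq_nonneg _)) (S.mu_ge y) hmm.le
          (mul_nonneg (hVp0 y) (sq_nonneg _))
      _ ≤ S.energyDensity a Vp (u n) y * S.mu y :=
        mul_le_mul_of_nonneg_right (S.mul_sq_le_energyDensity ha Vp _ y) (S.mu_pos y).le
      _ ≤ 1 := h2
  obtain ⟨f, -, hf⟩ := (isCompact_univ_pi fun _ : V =>
      isCompact_Icc (a := -√(1 / (θ * S.mumin))) (b := √(1 / (θ * S.mumin)))).ultrafilter_le_nhds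
    ((hyperfilter ℕ).map u) (by
      rw [le_principal_iff, Ultrafilter.mem_coe, Ultrafilter.mem_map]
      exact Filter.univ_mem' fun n y _ => abs_le.1 (hbd n y))
  replace hf : Tendsto u (hyperfilter ℕ) (𝓝 f) := hf
  have hfE : S.memE a Vp f := by
    refine summable_of_sum_le (c := 1) (S.energyDensity_mul_mu_nonneg ha hVp0 f) fun F => ?_
    have ht := tendsto_finsetSum F fun y _ => S.tendsto_innerDensity hf hf a Vp y
    simp only [innerDensity_self] at ht
    exact le_of_tendsto ht (Eventually.of_forall fun n => hsum n F)
  have hf0 : f = 0 := by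
    refine htot f hfE fun j => ?_
    have hle : ∀ t : ℝ, 0 < t → |S.innerE a Vp f (e j)| ≤ t := by
      intro t ht
      have hF : ∀ F : Finset V, |∑ y ∈ F, S.innerDensity a Vp f (e j) y * S.mu y| ≤
          t + t⁻¹ * (S.integral (S.energyDensity a Vp (e j)) -
            ∑ y ∈ F, S.energyDensity a Vp (e j) y * S.mu y) := by
        intro F
        have hl := (tendsto_finsetSum F fun y _ =>
          S.tendsto_innerDensity hf (tendsto_const_nhds (x := e j)) a Vp y).abs
        refine le_of_tendsto hl ?_
        filter_upwards [Nat.hyperfilter_le_atTop (eventually_gt_atTop j)] with n hn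
        exact S.abs_sum_innerDensity_le_of_innerE_eq_zero ha hVp0 (hu n) (he j) (h1 n)
          (ho n j hn) ht F
      have hl1 : Tendsto (fun F : Finset V =>
          |∑ y ∈ F, S.innerDensity a Vp f (e j) y * S.mu y|) atTop
          (𝓝 |S.innerE a Vp f (e j)|) :=
        (S.summable_innerDensity ha hVp0 hfE (he j)).hasSum.abs
      have hl2 : Tendsto (fun F : Finset V => t + t⁻¹ * (S.integral (S.energyDensity a Vp (e j)) -
            ∑ y ∈ F, S.energyDensity a Vp (e j) y * S.mu y)) atTop
          (𝓝 (t + t⁻¹ * (S.integral (S.energyDensity a Vp (e j)) -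
            S.integral (S.energyDensity a Vp (e j))))) :=
        ((tendsto_const_nhds.sub (Summable.hasSum (he j))).const_mul _).const_add _
      simpa using le_of_tendsto_of_tendsto' hl1 hl2 hF
    exact abs_nonpos_iff.1 (le_of_forall_pos_le_add fun t ht => by simpa using hle t ht)
  have hfx : Tendsto (fun n => u n x ^ 2) (hyperfilter ℕ) (𝓝 (f x ^ 2)) :=
    (tendsto_pi_nhds.1 hf x).pow 2
  have := ge_of_tendsto hfx (Eventually.of_forall fun n => (hx n).le)
  simp [hf0] at this
  linarith

lemma normLr_nonneg (r : ℝ) (u : V → ℝ) : 0 ≤ S.normLr r u :=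
  Real.rpow_nonneg (tsum_nonneg fun x =>
    mul_nonneg (Real.rpow_nonneg (abs_nonneg _) _) (S.mu_pos x).le) _

lemma normLr_le_of_sum_sq_le {r : ℝ} (hr : 2 ≤ r) {u : V → ℝ} {ε : ℝ} (hε : 0 < ε)
    (h : ∀ F : Finset V, ∑ x ∈ F, u x ^ 2 * S.mu x ≤ min S.mumin (ε ^ r)) :
    S.normLr r u ≤ ε := by
  have hu : ∀ x, |u x| ≤ 1 := by
    intro x
    have h1 := h {x}
    rw [Finset.sum_singleton] at h1
    have h2 : u x ^ 2 * S.mu x ≤ 1 * S.mu x := by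
      rw [one_mul]
      exact h1.trans ((min_le_left _ _).trans (S.mu_ge x))
    exact abs_le_one_iff_mul_self_le_one.2 (by
      rw [← pow_two]; exact le_of_mul_le_mul_right h2 (S.mu_pos x))
  have hpt : ∀ x, |u x| ^ r * S.mu x ≤ u x ^ 2 * S.mu x := by
    intro x
    refine mul_le_mul_of_nonneg_right ?_ (S.mu_pos x).le
    rw [← sq_abs, ← Real.rpow_natCast]
    exact Real.rpow_le_rpow_of_exponent_ge_of_imp (abs_nonneg _) (hu x) (by simpa using hr)
      (fun _ h0 => absurd h0 (by linarith))
  have hint : (S.integral fun x => |u x| ^ r) ≤ ε ^ r :=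
    Real.tsum_le_of_sum_le
      (fun x => mul_nonneg (Real.rpow_nonneg (abs_nonneg _) _) (S.mu_pos x).le)
      fun F => (Finset.sum_le_sum fun x _ => hpt x).trans ((h F).trans (min_le_right _ _))
  have hr0 : 0 < r := by linarith
  calc S.normLr r u ≤ (ε ^ r) ^ (1 / r) :=
        Real.rpow_le_rpow (tsum_nonneg fun x =>
          mul_nonneg (Real.rpow_nonneg (abs_nonneg _) _) (S.mu_pos x).le) hint (by positivity)
    _ = ε := by rw [one_div, Real.rpow_rpow_inv hε.le hr0.ne']

/-- The `L^r` norm is uniformly small on elements of the unit ball of `E` orthogonal to the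
first `k` elements of a total family, for `k` large. -/
lemma eventually_normLr_le {a : ℝ} (ha : 0 ≤ a) {Vp : V → ℝ} {θ : ℝ} (hθ : 0 < θ)
    (hVp : ∀ x, θ ≤ Vp x) (hfin : ∀ M : ℝ, {x | Vp x < M}.Finite)
    {e : ℕ → V → ℝ} (he : ∀ j, S.memE a Vp (e j))
    (htot : ∀ u : V → ℝ, S.memE a Vp u → (∀ j, S.innerE a Vp u (e j) = 0) → u = 0)
    {r : ℝ} (hr : 2 ≤ r) {ε : ℝ} (hε : 0 < ε) :
    ∀ᶠ k : ℕ in atTop, ∀ u : V → ℝ, S.memE a Vp u → (∀ j < k, S.innerE a Vp u (e j) = 0) →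
      S.normE a Vp u ≤ 1 → S.normLr r u ≤ ε := by
  classical
  have hVp0 : ∀ x, 0 ≤ Vp x := fun x => hθ.le.trans (hVp x)
  obtain ⟨η, hη, hη0⟩ : ∃ η, η = min S.mumin (ε ^ r) ∧ 0 < η :=
    ⟨_, rfl, lt_min S.mumin_pos (by positivity)⟩
  set K := (hfin (2 / η)).toFinset
  have hm0 : 0 ≤ ∑ x ∈ K, S.mu x := Finset.sum_nonneg fun x _ => (S.mu_pos x).le
  set δ := η / 2 / (∑ x ∈ K, S.mu x + 1)
  have hδ : 0 < δ := by positivity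
  have hev := (eventually_all_finset K).2 fun x _ =>
    S.eventually_sq_apply_le ha hθ hVp he htot x hδ
  filter_upwards [hev] with k hk u hu ho h1
  have h1' : S.integral (S.energyDensity a Vp u) ≤ 1 := by
    simpa using (Real.sqrt_le_left zero_le_one).1 h1
  refine S.normLr_le_of_sum_sq_le hr hε fun F => ?_
  rw [← hη, ← Finset.sum_filter_add_sum_filter_not F (· ∈ K)]
  have hin : ∑ x ∈ F with x ∈ K, u x ^ 2 * S.mu x ≤ η / 2 := by
    calc ∑ x ∈ F with x ∈ K, u x ^ 2 * S.mu x ≤ ∑ x ∈ K, u x ^ 2 * S.mu x :=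
          Finset.sum_le_sum_of_subset_of_nonneg (fun x hx => (Finset.mem_filter.1 hx).2)
            fun x _ _ => mul_nonneg (sq_nonneg _) (S.mu_pos x).le
      _ ≤ ∑ x ∈ K, δ * S.mu x := Finset.sum_le_sum fun x hx =>
          mul_le_mul_of_nonneg_right (hk x hx u hu ho h1') (S.mu_pos x).le
      _ = δ * ∑ x ∈ K, S.mu x := (Finset.mul_sum _ _ _).symm
      _ ≤ δ * (∑ x ∈ K, S.mu x + 1) := by gcongr; linarith
      _ = η / 2 := div_mul_cancel₀ _ (by positivity)
  have hout : ∑ x ∈ F with x ∉ K, u x ^ 2 * S.mu x ≤ η / 2 := by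
    calc ∑ x ∈ F with x ∉ K, u x ^ 2 * S.mu x
        ≤ ∑ x ∈ F with x ∉ K, η / 2 * (S.energyDensity a Vp u x * S.mu x) := by
          refine Finset.sum_le_sum fun x hx => ?_
          have hx' : 2 / η ≤ Vp x := by simpa [K] using (Finset.mem_filter.1 hx).2
          rw [← mul_assoc]
          refine mul_le_mul_of_nonneg_right ?_ (S.mu_pos x).le
          calc u x ^ 2 = η / 2 * (2 / η * u x ^ 2) := by field_simp
            _ ≤ η / 2 * (Vp x * u x ^ 2) := by gcongr
            _ ≤ η / 2 * S.energyDensity a Vp u x := by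
              gcongr; exact S.mul_sq_le_energyDensity ha Vp u x
      _ = η / 2 * ∑ x ∈ F with x ∉ K, S.energyDensity a Vp u x * S.mu x :=
          (Finset.mul_sum _ _ _).symm
      _ ≤ η / 2 * 1 := by
          gcongr
          exact (Summable.sum_le_tsum _
            (fun y _ => S.energyDensity_mul_mu_nonneg ha hVp0 _ y) hu).trans h1'
      _ = η / 2 := mul_one _
  linarith

end WeightedGraph

/-- Lemma 3.6: under condition (V), for `2 ≤ r < ∞` the quantities
`β_k = sup { ‖u‖_r + ‖v‖_r : (u,v) ∈ Z_k, ‖(u,v)‖ = 1 }` tend to `0` as `k → ∞`.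
Here `Z_k` is the orthogonal complement in `E = E₁ × E₂` of the span of the first `k`
elements of total orthonormal bases `e₁`, `e₂` of `E₁`, `E₂`. -/
theorem beta_k_tendsto_zero
    {V : Type*} (S : WeightedGraph V)
    (a₁ a₂ : ℝ) (ha₁ : 0 < a₁) (ha₂ : 0 < a₂)
    (V₁ V₂ : V → ℝ) (θ₁ θ₂ : ℝ) (hV : S.CondV V₁ V₂ θ₁ θ₂)
    (e₁ e₂ : ℕ → V → ℝ)
    (he₁mem : ∀ j, S.memE a₁ V₁ (e₁ j)) (he₂mem : ∀ j, S.memE a₂ V₂ (e₂ j))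
    (he₁on : ∀ i j, S.innerE a₁ V₁ (e₁ i) (e₁ j) = if i = j then 1 else 0)
    (he₂on : ∀ i j, S.innerE a₂ V₂ (e₂ i) (e₂ j) = if i = j then 1 else 0)
    (he₁tot : ∀ u : V → ℝ, S.memE a₁ V₁ u → (∀ j, S.innerE a₁ V₁ u (e₁ j) = 0) → u = 0)
    (he₂tot : ∀ u : V → ℝ, S.memE a₂ V₂ u → (∀ j, S.innerE a₂ V₂ u (e₂ j) = 0) → u = 0)
    (r : ℝ) (hr : 2 ≤ r) :
    Tendsto (fun k : ℕ =>
        sSup { s : ℝ | ∃ u v : V → ℝ, S.memE a₁ V₁ u ∧ S.memE a₂ V₂ v ∧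
          (∀ j < k, S.innerE a₁ V₁ u (e₁ j) = 0) ∧
          (∀ j < k, S.innerE a₂ V₂ v (e₂ j) = 0) ∧
          S.normE a₁ V₁ u + S.normE a₂ V₂ v = 1 ∧
          s = S.normLr r u + S.normLr r v })
      atTop (nhds 0) := by
  obtain ⟨hg₁, hg₂, hθ₁, hθ₂, x₀, hx₀⟩ := hV
  have hle₁ : ∀ x, θ₁ ≤ V₁ x := fun x => hg₁.1 ⟨x, rfl⟩
  have hle₂ : ∀ x, θ₂ ≤ V₂ x := fun x => hg₂.1 ⟨x, rfl⟩
  have hfin₁ : ∀ M : ℝ, {x | V₁ x < M}.Finite := fun M => by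
    obtain ⟨N, hN⟩ := hx₀ M
    exact (S.finite_setOf_dist_lt x₀ N).subset fun x hx =>
      not_le.1 fun h => (hN x h).1.not_gt hx
  have hfin₂ : ∀ M : ℝ, {x | V₂ x < M}.Finite := fun M => by
    obtain ⟨N, hN⟩ := hx₀ M
    exact (S.finite_setOf_dist_lt x₀ N).subset fun x hx =>
      not_le.1 fun h => (hN x h).2.not_gt hx
  refine Metric.tendsto_nhds.2 fun ε hε => ?_
  have hε3 : 0 < ε / 3 := by positivity
  filter_upwards [S.eventually_normLr_le ha₁.le hθ₁ hle₁ hfin₁ he₁mem he₁tot hr hε3,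
    S.eventually_normLr_le ha₂.le hθ₂ hle₂ hfin₂ he₂mem he₂tot hr hε3] with k h₁ h₂
  rw [Real.dist_eq, sub_zero, abs_of_nonneg (Real.sSup_nonneg ?_)]
  · refine (Real.sSup_le (a := ε / 3 + ε / 3) ?_ (by positivity)).trans_lt (by linarith)
    rintro s ⟨u, v, hu, hv, hou, hov, hn, rfl⟩
    have hn₁ : 0 ≤ S.normE a₁ V₁ u := Real.sqrt_nonneg _
    have hn₂ : 0 ≤ S.normE a₂ V₂ v := Real.sqrt_nonneg _
    exact add_le_add (h₁ u hu hou (by linarith)) (h₂ v hv hov (by linarith))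
  · rintro s ⟨u, v, -, -, -, -, -, rfl⟩
    exact add_nonneg (S.normLr_nonneg r u) (S.normLr_nonneg r v)
end

section
/- Lemma 3.8. Suppose b₁,b₂≥0 and conditions (V), (F_0), (F_1), (C_2) hold, with ρ_* and α_* as in (C_2). Then for every k∈ℕ, Φ(u,v) ≥ α_* for all (u,v)∈Z_k with ‖(u,v)‖=ρ_*. -/
open Filter Topology

open WeightedGraph

namespace WeightedGraph

variable {V : Type*} (S : WeightedGraph V)

lemma energyDensity_nonneg {a : ℝ} (ha : 0 ≤ a) {Vp : V → ℝ} (hVp : ∀ x, 0 ≤ Vp x)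
    (u : V → ℝ) (x : V) : 0 ≤ S.energyDensity a Vp u x :=
  (mul_nonneg (hVp x) (sq_nonneg _)).trans (S.mul_sq_le_energyDensity ha Vp u x)

lemma integral_energyDensity_nonneg {a : ℝ} (ha : 0 ≤ a) {Vp : V → ℝ} (hVp : ∀ x, 0 ≤ Vp x)
    (u : V → ℝ) : 0 ≤ S.integral (S.energyDensity a Vp u) :=
  tsum_nonneg fun x => mul_nonneg (S.energyDensity_nonneg ha hVp u x) (S.mu_pos x).le

lemma normE_sq {a : ℝ} (ha : 0 ≤ a) {Vp : V → ℝ} (hVp : ∀ x, 0 ≤ Vp x) (u : V → ℝ) :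
    S.normE a Vp u ^ 2 = S.integral (S.energyDensity a Vp u) :=
  Real.sq_sqrt (S.integral_energyDensity_nonneg ha hVp u)

lemma gammaInf_nonneg (θ : ℝ) : 0 ≤ S.gammaInf θ :=
  one_div_nonneg.2 (Real.sqrt_nonneg _)

/-- The embedding of the energy space into `L^∞`, with constant `gammaInf θ`. -/
lemma abs_le_gammaInf_mul_normE {a θ : ℝ} (ha : 0 ≤ a) (hθ : 0 < θ) {Vp : V → ℝ}
    (hVp : ∀ x, θ ≤ Vp x) {u : V → ℝ} (hu : S.memE a Vp u) (x : V) :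
    |u x| ≤ S.gammaInf θ * S.normE a Vp u := by
  have hVp0 : ∀ x, 0 ≤ Vp x := fun x => hθ.le.trans (hVp x)
  have hpoint : S.energyDensity a Vp u x * S.mu x ≤ S.integral (S.energyDensity a Vp u) :=
    hu.le_tsum x fun y _ =>
      mul_nonneg (S.energyDensity_nonneg ha hVp0 u y) (S.mu_pos y).le
  have hle : S.mumin * θ * u x ^ 2 ≤ S.integral (S.energyDensity a Vp u) :=
    calc S.mumin * θ * u x ^ 2 = (θ * u x ^ 2) * S.mumin := by ring
      _ ≤ S.energyDensity a Vp u x * S.mu x :=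
          mul_le_mul
            ((mul_le_mul_of_nonneg_right (hVp x) (sq_nonneg _)).trans
              (S.mul_sq_le_energyDensity ha Vp u x))
            (S.mu_ge x) S.mumin_pos.le (S.energyDensity_nonneg ha hVp0 u x)
      _ ≤ _ := hpoint
  have hc : 0 < S.mumin * θ := mul_pos S.mumin_pos hθ
  have hsqrt := Real.sqrt_le_sqrt hle
  rw [Real.sqrt_mul hc.le, Real.sqrt_sq_eq_abs] at hsqrt
  rw [gammaInf, one_div_mul_eq_div, le_div_iff₀ (Real.sqrt_pos.2 hc), mul_comm]
  exact hsqrt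

/-- If `|f| ≤ c * b` with `b` integrable, then `∫ f ≤ c * ∫ b`. -/
lemma integral_le_mul_integral {f b : V → ℝ} {c : ℝ} (hf : ∀ x, |f x| ≤ c * b x)
    (hb : Summable fun x => b x * S.mu x) : S.integral f ≤ c * S.integral b := by
  have hcb : Summable fun x => c * (b x * S.mu x) := hb.mul_left c
  have habs : ∀ x, |f x * S.mu x| ≤ c * (b x * S.mu x) := fun x => by
    rw [abs_mul, abs_of_pos (S.mu_pos x), ← mul_assoc]
    exact mul_le_mul_of_nonneg_right (hf x) (S.mu_pos x).le
  have hfs : Summable fun x => f x * S.mu x := Summable.of_norm_bounded hcb habs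
  unfold integral
  rw [← tsum_mul_left]
  exact hfs.tsum_le_tsum (fun x => (le_abs_self _).trans (habs x)) hcb

end WeightedGraph

/-- Lemma 3.8: under (V), (F₀), (F₁), (C₂) (with `ρ_*, α_*` as in (C₂)), for every `k`
one has `Φ ≥ α_*` on the sphere `∂B_{ρ_*} ∩ Z_k`. -/
theorem mountain_pass_geometry_C2
    {V : Type*} (S : WeightedGraph V)
    (a₁ a₂ b₁ b₂ : ℝ) (ha₁ : 0 < a₁) (ha₂ : 0 < a₂) (hb₁ : 0 ≤ b₁) (hb₂ : 0 ≤ b₂)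
    (V₁ V₂ : V → ℝ) (θ₁ θ₂ : ℝ) (hV : S.CondV V₁ V₂ θ₁ θ₂)
    (F Fs Ft : V → ℝ → ℝ → ℝ) (hFder : IsPartialDerivs F Fs Ft)
    (a : ℝ → ℝ) (b : V → ℝ)
    (hF0 : CondF0 F) (hF1 : S.CondF1 F Fs Ft a b)
    (ρStar : ℝ) (hρStar : 0 < ρStar)
    (hC2 : 0 < ρStar ^ 2 / 4 -
      sSup (a '' Set.Icc 0 ((S.gammaInf θ₁ + S.gammaInf θ₂) * ρStar)) * S.integral b)
    (e₁ e₂ : ℕ → V → ℝ)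
    (he₁mem : ∀ j, S.memE a₁ V₁ (e₁ j)) (he₂mem : ∀ j, S.memE a₂ V₂ (e₂ j))
    (he₁on : ∀ i j, S.innerE a₁ V₁ (e₁ i) (e₁ j) = if i = j then 1 else 0)
    (he₂on : ∀ i j, S.innerE a₂ V₂ (e₂ i) (e₂ j) = if i = j then 1 else 0)
    (he₁tot : ∀ u : V → ℝ, S.memE a₁ V₁ u → (∀ j, S.innerE a₁ V₁ u (e₁ j) = 0) → u = 0)
    (he₂tot : ∀ u : V → ℝ, S.memE a₂ V₂ u → (∀ j, S.innerE a₂ V₂ u (e₂ j) = 0) → u = 0) :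
    ∀ k : ℕ, ∀ u v : V → ℝ, S.memE a₁ V₁ u → S.memE a₂ V₂ v →
      (∀ j < k, S.innerE a₁ V₁ u (e₁ j) = 0) →
      (∀ j < k, S.innerE a₂ V₂ v (e₂ j) = 0) →
      S.normE a₁ V₁ u + S.normE a₂ V₂ v = ρStar →
      ρStar ^ 2 / 4 -
          sSup (a '' Set.Icc 0 ((S.gammaInf θ₁ + S.gammaInf θ₂) * ρStar)) * S.integral b
        ≤ S.Phi a₁ a₂ b₁ b₂ V₁ V₂ F u v := by
  intro k u v hu hv _ _ hnorm
  obtain ⟨hθ₁, hθ₂, hθ₁pos, hθ₂pos, -⟩ := hV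
  obtain ⟨ha, -, hbpos, hb, hF⟩ := hF1
  have hV₁ : ∀ x, θ₁ ≤ V₁ x := fun x => hθ₁.1 ⟨x, rfl⟩
  have hV₂ : ∀ x, θ₂ ≤ V₂ x := fun x => hθ₂.1 ⟨x, rfl⟩
  have hnu : 0 ≤ S.normE a₁ V₁ u := Real.sqrt_nonneg _
  have hnv : 0 ≤ S.normE a₂ V₂ v := Real.sqrt_nonneg _
  have hbdd : BddAbove (a '' Set.Icc 0 ((S.gammaInf θ₁ + S.gammaInf θ₂) * ρStar)) :=
    (isCompact_Icc.image_of_continuousOn (ha.mono fun r hr => hr.1)).bddAbove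
  have hmem : ∀ x, √(u x ^ 2 + v x ^ 2) ∈
      Set.Icc 0 ((S.gammaInf θ₁ + S.gammaInf θ₂) * ρStar) := fun x => by
    refine ⟨Real.sqrt_nonneg _, ?_⟩
    have hux := S.abs_le_gammaInf_mul_normE ha₁.le hθ₁pos hV₁ hu x
    have hvx := S.abs_le_gammaInf_mul_normE ha₂.le hθ₂pos hV₂ hv x
    have hsqrt : √(u x ^ 2 + v x ^ 2) ≤ |u x| + |v x| := by
      refine Real.sqrt_le_iff.2 ⟨by positivity, ?_⟩
      rw [← sq_abs (u x), ← sq_abs (v x)]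
      nlinarith [abs_nonneg (u x), abs_nonneg (v x)]
    rw [← hnorm]
    nlinarith [mul_nonneg (S.gammaInf_nonneg θ₁) hnv, mul_nonneg (S.gammaInf_nonneg θ₂) hnu]
  have hint := S.integral_le_mul_integral (f := fun x => F x (u x) (v x))
    (fun x => (hF x (u x) (v x)).2.2.trans
      (mul_le_mul_of_nonneg_right (le_csSup hbdd (Set.mem_image_of_mem a (hmem x)))
        (hbpos x).le)) hb
  have hgu : 0 ≤ (b₁ / 4) * (S.integral (S.gradSq u)) ^ 2 := by positivity
  have hgv : 0 ≤ (b₂ / 4) * (S.integral (S.gradSq v)) ^ 2 := by positivity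
  have hsq : ρStar ^ 2 / 4 ≤ (1 / 2) * S.normE a₁ V₁ u ^ 2 + (1 / 2) * S.normE a₂ V₂ v ^ 2 := by
    rw [← hnorm]
    nlinarith [sq_nonneg (S.normE a₁ V₁ u - S.normE a₂ V₂ v)]
  rw [S.normE_sq ha₁.le fun x => hθ₁pos.le.trans (hV₁ x),
    S.normE_sq ha₂.le fun x => hθ₂pos.le.trans (hV₂ x)] at hsq
  unfold Phi
  linarith
end
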